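/- Let n ≥ 2, let Jⁿ = [−1,1]ⁿ ⊆ ℝⁿ with the subspace topology, let ∂Jⁿ = Jⁿ ∖ (−1,1)ⁿ, and let m denote the restriction of n-dimensional Lebesgue measure to Jⁿ. Then the subspace of C(Jⁿ,Jⁿ) (with the compact-open topology) consisting of homeomorphisms h of Jⁿ with h(x) = x for all x ∈ ∂Jⁿ and h_*m = m is not compact. -/

import Mathlib

open MeasureTheory

/-- The cube `Jⁿ = [-1,1]ⁿ ⊆ ℝⁿ`. -/
def cubeJ (n : ℕ) : Set (Fin n → ℝ) := Set.Icc (-1) 1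

/-- The boundary `∂Jⁿ = Jⁿ ∖ (-1,1)ⁿ`, as a subset of the cube. -/
def cubeJBoundary (n : ℕ) : Set ↥(cubeJ n) :=
  {x | ¬ ∀ i : Fin n, -1 < (x : Fin n → ℝ) i ∧ (x : Fin n → ℝ) i < 1}

/-- The restriction of `n`-dimensional Lebesgue measure to `Jⁿ`. -/
noncomputable def lebesgueOnJ (n : ℕ) : Measure ↥(cubeJ n) :=
  Measure.comap Subtype.val (volume : Measure (Fin n → ℝ))

open Filter Topology

section Twist

/-- If `φ` is invariant under the measure-preserving maps `R t` and takes countably many values, then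
`x ↦ R (φ x) x` preserves the measure. -/
theorem measurePreserving_twist_of_countable {X : Type*} [MeasurableSpace X] {μ : Measure X}
    {R : ℝ → X → X} (hR : ∀ t, MeasurePreserving (R t) μ μ) {φ : X → ℝ} (hφ : Measurable φ)
    (hinv : ∀ t x, φ (R t x) = φ x) (hc : (Set.range φ).Countable)
    (hm : Measurable fun x => R (φ x) x) : MeasurePreserving (fun x => R (φ x) x) μ μ := by
  refine ⟨hm, Measure.ext fun A hA => ?_⟩
  have := hc.to_subtype
  have split : ∀ B : Set X, MeasurableSet B →
      μ B = ∑' c : Set.range φ, μ (φ ⁻¹' {(c : ℝ)} ∩ B) := by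
    intro B hB
    rw [← measure_iUnion]
    · congr 1
      ext x
      simp
    · intro c d hcd
      refine Set.disjoint_left.2 fun x hx hy => hcd (Subtype.ext ?_)
      exact hx.1.symm.trans hy.1
    · exact fun c => (hφ (measurableSet_singleton _)).inter hB
  rw [Measure.map_apply hm hA, split _ (hm hA), split A hA]
  refine tsum_congr fun c => ?_
  rw [← (hR c).measure_preimage ((hφ (measurableSet_singleton _)).inter hA).nullMeasurableSet]
  congr 1
  ext x
  simp only [Set.mem_inter_iff, Set.mem_preimage, Set.mem_singleton_iff, hinv]
  constructor <;> rintro ⟨h, h'⟩ <;> simp_all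

/-- If `φ` is invariant under the measure-preserving maps `R t`, then `x ↦ R (φ x) x` preserves the
measure. -/
theorem measurePreserving_twist {X : Type*} [PseudoMetricSpace X] [SecondCountableTopology X]
    [MeasurableSpace X] [BorelSpace X]
    {μ : Measure X} [IsFiniteMeasure μ] {R : ℝ → X → X}
    (hcont : Continuous fun p : ℝ × X => R p.1 p.2)
    (hR : ∀ t, MeasurePreserving (R t) μ μ) {φ : X → ℝ} (hφ : Measurable φ)
    (hinv : ∀ t x, φ (R t x) = φ x) : MeasurePreserving (fun x => R (φ x) x) μ μ := by
  have meas : ∀ ψ : X → ℝ, Measurable ψ → Measurable fun x => R (ψ x) x := fun ψ hψ =>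
    hcont.measurable.comp (hψ.prodMk measurable_id)
  refine ⟨meas φ hφ, ?_⟩
  refine ext_of_forall_integral_eq_of_IsFiniteMeasure fun f => ?_
  rw [integral_map (meas φ hφ).aemeasurable f.continuous.aestronglyMeasurable]
  let ψ : ℕ → X → ℝ := fun m x => (⌊φ x * (m + 1)⌋ : ℝ) / (m + 1)
  have hψm : ∀ m, Measurable (ψ m) := fun m => by
    have : Measurable fun x => ⌊φ x * ((m : ℝ) + 1)⌋ := Int.measurable_floor.comp (hφ.mul_const _)
    exact (Measurable.of_discrete.comp this).div_const _
  have hψ : ∀ m, MeasurePreserving (fun x => R (ψ m x) x) μ μ := fun m => by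
    refine measurePreserving_twist_of_countable hR (hψm m) (fun t x => ?_) ?_ (meas _ (hψm m))
    · simp only [ψ, hinv]
    · refine (Set.countable_range fun z : ℤ => (z : ℝ) / (m + 1)).mono ?_
      rintro _ ⟨x, rfl⟩
      exact ⟨_, rfl⟩
  have hlim : ∀ x, Tendsto (fun m => ψ m x) atTop (𝓝 (φ x)) := fun x => by
    have hlow : Tendsto (fun m : ℕ => φ x - 1 / ((m : ℝ) + 1)) atTop (𝓝 (φ x)) := by
      simpa using (tendsto_one_div_add_atTop_nhds_zero_nat (𝕜 := ℝ)).const_sub (φ x)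
    refine tendsto_of_tendsto_of_tendsto_of_le_of_le hlow tendsto_const_nhds
      (fun m => ?_) fun m => ?_
    · have hm : (0 : ℝ) < (m : ℝ) + 1 := by positivity
      have : (φ x - 1 / ((m : ℝ) + 1)) * ((m : ℝ) + 1) = φ x * ((m : ℝ) + 1) - 1 := by field_simp
      simp only [ψ]
      rw [le_div_iff₀ hm, this]
      exact (Int.sub_one_lt_floor _).le
    · exact (div_le_iff₀ (by positivity)).2 (Int.floor_le _)
  refine tendsto_nhds_unique (f := fun m => ∫ x, f (R (ψ m x) x) ∂μ) (l := atTop) ?_ ?_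
  · refine tendsto_integral_of_dominated_convergence (fun _ => ‖f‖)
      (fun m => (f.continuous.measurable.comp (meas _ (hψm m))).aestronglyMeasurable)
      (integrable_const _) (fun m => ae_of_all _ fun x => f.norm_coe_le_norm _)
      (ae_of_all _ fun x => ?_)
    have h : Continuous fun t => f (R t x) :=
      f.continuous.comp (hcont.comp (continuous_id.prodMk continuous_const))
    exact (h.tendsto (φ x)).comp (hlim x)
  · refine tendsto_const_nhds.congr fun m => ?_
    conv_lhs => rw [← (hψ m).map_eq]
    exact integral_map (hψ m).measurable.aemeasurable f.continuous.aestronglyMeasurable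

end Twist

section PlaneRotation

variable {ι : Type*} [DecidableEq ι]

/-- The rotation by the angle `t` in the plane of the coordinates `i` and `j`. -/
noncomputable def planeRotation (i j : ι) (t : ℝ) : (ι → ℝ) →ₗ[ℝ] (ι → ℝ) where
  toFun x k := if k = i then Real.cos t * x i - Real.sin t * x j
    else if k = j then Real.sin t * x i + Real.cos t * x j else x k
  map_add' x y := by
    ext k
    simp only [Pi.add_apply]
    split_ifs <;> ring
  map_smul' c x := by
    ext k
    simp only [Pi.smul_apply, smul_eq_mul, RingHom.id_apply]
    split_ifs <;> ring

/-- The reflection changing the sign of the coordinate `j`. -/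
def coordReflection (j : ι) : (ι → ℝ) →ₗ[ℝ] (ι → ℝ) where
  toFun x k := if k = j then - x k else x k
  map_add' x y := by
    ext k
    simp only [Pi.add_apply]
    split_ifs <;> ring
  map_smul' c x := by
    ext k
    simp only [Pi.smul_apply, smul_eq_mul, RingHom.id_apply]
    split_ifs <;> ring

theorem planeRotation_apply (i j : ι) (t : ℝ) (x : ι → ℝ) (k : ι) :
    planeRotation i j t x k = if k = i then Real.cos t * x i - Real.sin t * x j
      else if k = j then Real.sin t * x i + Real.cos t * x j else x k := rfl

theorem planeRotation_apply_left (i j : ι) (t : ℝ) (x : ι → ℝ) :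
    planeRotation i j t x i = Real.cos t * x i - Real.sin t * x j := by
  simp [planeRotation_apply]

theorem planeRotation_apply_right {i j : ι} (hij : i ≠ j) (t : ℝ) (x : ι → ℝ) :
    planeRotation i j t x j = Real.sin t * x i + Real.cos t * x j := by
  simp [planeRotation_apply, hij.symm]

theorem planeRotation_apply_of_ne {i j k : ι} (hi : k ≠ i) (hj : k ≠ j) (t : ℝ) (x : ι → ℝ) :
    planeRotation i j t x k = x k := by
  simp [planeRotation_apply, hi, hj]

theorem planeRotation_zero (i j : ι) (x : ι → ℝ) : planeRotation i j 0 x = x := by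
  ext k
  rw [planeRotation_apply]
  split_ifs <;> simp_all

theorem planeRotation_neg_apply_planeRotation {i j : ι} (hij : i ≠ j) (t : ℝ) (x : ι → ℝ) :
    planeRotation i j (-t) (planeRotation i j t x) = x := by
  ext k
  rw [planeRotation_apply i j (-t), planeRotation_apply_left, planeRotation_apply_right hij,
    Real.cos_neg, Real.sin_neg]
  split_ifs with h h'
  · subst h
    linear_combination x k * Real.sin_sq_add_cos_sq t
  · subst h'
    linear_combination x k * Real.sin_sq_add_cos_sq t
  · exact planeRotation_apply_of_ne h h' t x

theorem planeRotation_sq_add_sq {i j : ι} (hij : i ≠ j) (t : ℝ) (x : ι → ℝ) :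
    planeRotation i j t x i ^ 2 + planeRotation i j t x j ^ 2 = x i ^ 2 + x j ^ 2 := by
  rw [planeRotation_apply_left, planeRotation_apply_right hij]
  linear_combination (x i ^ 2 + x j ^ 2) * Real.sin_sq_add_cos_sq t

theorem coordReflection_comp_planeRotation {i j : ι} (hij : i ≠ j) (t : ℝ) :
    coordReflection j ∘ₗ planeRotation i j t ∘ₗ coordReflection j = planeRotation i j (-t) := by
  refine LinearMap.ext fun x => funext fun k => ?_
  simp only [LinearMap.comp_apply]
  rw [planeRotation_apply i j (-t)]
  simp only [coordReflection, LinearMap.coe_mk, AddHom.coe_mk, planeRotation_apply, Real.cos_neg,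
    Real.sin_neg]
  split_ifs <;> simp_all [add_comm]

theorem continuous_planeRotation (i j : ι) :
    Continuous fun p : ℝ × (ι → ℝ) => planeRotation i j p.1 p.2 := by
  refine continuous_pi fun k => ?_
  simp only [planeRotation_apply]
  split_ifs <;> fun_prop

theorem abs_det_planeRotation {i j : ι} (hij : i ≠ j) (t : ℝ) :
    |LinearMap.det (planeRotation i j t)| = 1 := by
  have hS : coordReflection j ∘ₗ coordReflection j = (LinearMap.id : (ι → ℝ) →ₗ[ℝ] (ι → ℝ)) := by
    refine LinearMap.ext fun x => funext fun k => ?_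
    simp only [coordReflection, LinearMap.comp_apply, LinearMap.coe_mk, AddHom.coe_mk]
    split_ifs <;> simp
  have hinv : planeRotation i j (-t) ∘ₗ planeRotation i j t = LinearMap.id :=
    LinearMap.ext fun x => planeRotation_neg_apply_planeRotation hij t x
  have h1 := congrArg LinearMap.det hS
  have h2 := congrArg LinearMap.det hinv
  have h3 := congrArg LinearMap.det (coordReflection_comp_planeRotation hij t)
  rw [LinearMap.det_comp, LinearMap.det_id] at h1 h2
  rw [LinearMap.det_comp, LinearMap.det_comp] at h3
  rw [← pow_eq_one_iff_of_nonneg (abs_nonneg _) two_ne_zero, sq_abs]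
  rw [← h3] at h2
  linear_combination h2 - LinearMap.det (planeRotation i j t) ^ 2 * h1

variable [Fintype ι]

theorem measurePreserving_planeRotation {i j : ι} (hij : i ≠ j) (t : ℝ) :
    MeasurePreserving (planeRotation i j t) (volume : Measure (ι → ℝ)) volume := by
  have hdet := abs_det_planeRotation hij t
  refine ⟨(planeRotation i j t).continuous_of_finiteDimensional.measurable, ?_⟩
  rw [Real.map_linearMap_volume_pi_eq_smul_volume_pi, abs_inv, hdet]
  · simp
  · intro h
    simp [h] at hdet

/-- A function on `ℝ^ι`, invariant under the rotations of the `(i, j)`-plane and vanishing on the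
boundary of the cube. -/
noncomputable def twistAngle (i j : ι) (x : ι → ℝ) : ℝ :=
  max 0 (1 - (x i ^ 2 + x j ^ 2)) * ∏ k ∈ Finset.univ \ {i, j}, (1 - x k ^ 2)

theorem continuous_twistAngle (i j : ι) : Continuous (twistAngle i j) := by
  unfold twistAngle
  fun_prop

theorem twistAngle_planeRotation {i j : ι} (hij : i ≠ j) (t : ℝ) (x : ι → ℝ) :
    twistAngle i j (planeRotation i j t x) = twistAngle i j x := by
  unfold twistAngle
  rw [planeRotation_sq_add_sq hij]
  congr 1
  refine Finset.prod_congr rfl fun k hk => ?_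
  simp only [Finset.mem_sdiff, Finset.mem_univ, Finset.mem_insert, Finset.mem_singleton, true_and,
    not_or] at hk
  rw [planeRotation_apply_of_ne hk.1 hk.2]

/-- The twist rotating the `(i, j)`-coordinates of `x` by the angle `s * twistAngle i j x`. -/
noncomputable def twistMap (i j : ι) (s : ℝ) (x : ι → ℝ) : ι → ℝ :=
  planeRotation i j (s * twistAngle i j x) x

theorem continuous_twistMap (i j : ι) (s : ℝ) : Continuous (twistMap i j s) :=
  (continuous_planeRotation i j).comp (g := fun p : ℝ × (ι → ℝ) => planeRotation i j p.1 p.2)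
    (f := fun x => (s * twistAngle i j x, x))
    (((continuous_twistAngle i j).const_mul s).prodMk continuous_id)

theorem twistMap_neg_twistMap {i j : ι} (hij : i ≠ j) (s : ℝ) (x : ι → ℝ) :
    twistMap i j (-s) (twistMap i j s x) = x := by
  unfold twistMap
  rw [twistAngle_planeRotation hij, neg_mul, planeRotation_neg_apply_planeRotation hij]

theorem twistMap_of_twistAngle_eq_zero {i j : ι} {x : ι → ℝ} (h : twistAngle i j x = 0) (s : ℝ) :
    twistMap i j s x = x := by
  rw [twistMap, h, mul_zero, planeRotation_zero]

theorem sq_add_sq_lt_one_of_twistAngle_ne_zero {i j : ι} {x : ι → ℝ} (h : twistAngle i j x ≠ 0) :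
    x i ^ 2 + x j ^ 2 < 1 := by
  by_contra! hle
  exact h (by rw [twistAngle, max_eq_left (by linarith), zero_mul])

theorem twistAngle_eq_zero_of_sq_eq_one {i j k : ι} {x : ι → ℝ} (h : x k ^ 2 = 1) :
    twistAngle i j x = 0 := by
  unfold twistAngle
  by_cases hk : k = i ∨ k = j
  · rw [max_eq_left, zero_mul]
    rcases hk with rfl | rfl
    · linarith [sq_nonneg (x j)]
    · linarith [sq_nonneg (x i)]
  · rw [Finset.prod_eq_zero (i := k), mul_zero]
    · simpa using hk
    · rw [h, sub_self]

/-- A twist preserves Lebesgue measure on a rotation-invariant set of finite volume. -/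
theorem measurePreserving_twistMap {i j : ι} (hij : i ≠ j) (s : ℝ) {B : Set (ι → ℝ)}
    (hB : MeasurableSet B) (hfin : volume B ≠ ⊤) (hinv : ∀ t, planeRotation i j t ⁻¹' B = B) :
    MeasurePreserving (twistMap i j s) (volume.restrict B) (volume.restrict B) := by
  have : IsFiniteMeasure (volume.restrict B) := isFiniteMeasure_restrict.2 hfin
  refine measurePreserving_twist (R := fun t => planeRotation i j t)
    (continuous_planeRotation i j) (fun t => ?_)
    ((continuous_twistAngle i j).const_mul s).measurable
    fun t x => by simp only [twistAngle_planeRotation hij]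
  have := (measurePreserving_planeRotation hij t).restrict_preimage hB
  rwa [hinv] at this

end PlaneRotation

section Cube

variable {n : ℕ}

theorem mem_cubeJ_iff {x : Fin n → ℝ} : x ∈ cubeJ n ↔ ∀ k, x k ^ 2 ≤ 1 := by
  simp only [cubeJ, Set.mem_Icc, Pi.le_def, ← forall_and, sq_le_one_iff_abs_le_one, abs_le]
  rfl

theorem sq_eq_one_of_mem_cubeJBoundary {x : cubeJ n} (hx : x ∈ cubeJBoundary n) :
    ∃ k, (x : Fin n → ℝ) k ^ 2 = 1 := by
  by_contra! h
  refine hx fun k => ?_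
  have := lt_of_le_of_ne (mem_cubeJ_iff.1 x.2 k) (h k)
  exact abs_lt.1 (sq_lt_one_iff_abs_lt_one _ |>.1 this)

theorem twistMap_mem_cubeJ {i j : Fin n} (hij : i ≠ j) (s : ℝ) {x : Fin n → ℝ} (hx : x ∈ cubeJ n) :
    twistMap i j s x ∈ cubeJ n := by
  by_cases h : twistAngle i j x = 0
  · rwa [twistMap_of_twistAngle_eq_zero h]
  rw [mem_cubeJ_iff] at hx ⊢
  intro k
  have h1 := sq_add_sq_lt_one_of_twistAngle_ne_zero h
  have h2 := planeRotation_sq_add_sq hij (s * twistAngle i j x) x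
  unfold twistMap
  by_cases hi : k = i
  · subst hi
    nlinarith [sq_nonneg (planeRotation k j (s * twistAngle k j x) x j)]
  by_cases hj : k = j
  · subst hj
    nlinarith [sq_nonneg (planeRotation i k (s * twistAngle i k x) x i)]
  rw [planeRotation_apply_of_ne hi hj]
  exact hx k

theorem volume_preimage_twistMap {i j : Fin n} (hij : i ≠ j) (s : ℝ) {A : Set (Fin n → ℝ)}
    (hA : MeasurableSet A) (hAJ : A ⊆ cubeJ n) : volume (twistMap i j s ⁻¹' A) = volume A := by
  let B : Set (Fin n → ℝ) := {x | x i ^ 2 + x j ^ 2 ≤ 2 ∧ ∀ k, k ≠ i → k ≠ j → x k ^ 2 ≤ 1}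
  have hJB : cubeJ n ⊆ B := fun x hx => by
    rw [mem_cubeJ_iff] at hx
    exact ⟨by linarith [hx i, hx j], fun k _ _ => hx k⟩
  have hB : MeasurableSet B := by
    refine IsClosed.measurableSet ?_
    simp only [B, Set.ofPred_and, Set.ofPred_forall]
    refine IsClosed.inter (isClosed_le (by fun_prop) continuous_const) ?_
    exact isClosed_iInter fun k => isClosed_iInter fun _ => isClosed_iInter fun _ =>
      isClosed_le (by fun_prop) continuous_const
  have hfin : volume B ≠ ⊤ := by
    refine ((measure_mono fun x hx => ?_).trans_lt
      (isCompact_Icc (a := (fun _ => -2 : Fin n → ℝ)) (b := fun _ => 2)).measure_lt_top).ne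
    have h : ∀ k, x k ^ 2 ≤ 2 := fun k => by
      by_cases hi : k = i
      · subst hi
        nlinarith [hx.1, sq_nonneg (x j)]
      by_cases hj : k = j
      · subst hj
        nlinarith [hx.1, sq_nonneg (x i)]
      linarith [hx.2 k hi hj]
    exact ⟨fun k => by nlinarith [h k], fun k => by nlinarith [h k]⟩
  have hinv : ∀ t, planeRotation i j t ⁻¹' B = B := fun t => by
    ext x
    simp only [B, Set.mem_preimage, Set.mem_ofPred_eq, planeRotation_sq_add_sq hij]
    refine and_congr_right fun _ => forall_congr' fun k => forall_congr' fun hi =>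
      forall_congr' fun hj => ?_
    rw [planeRotation_apply_of_ne hi hj]
  have h := (measurePreserving_twistMap hij s hB hfin hinv).measure_preimage hA.nullMeasurableSet
  have hpre : twistMap i j s ⁻¹' A ⊆ cubeJ n := fun x hx => by
    rw [← twistMap_neg_twistMap hij s x]
    exact twistMap_mem_cubeJ hij _ (hAJ hx)
  rwa [Measure.restrict_eq_self _ (hpre.trans hJB), Measure.restrict_eq_self _ (hAJ.trans hJB)] at h

/-- The twist of the cube, as a homeomorphism. -/
noncomputable def cubeTwist {i j : Fin n} (hij : i ≠ j) (s : ℝ) : cubeJ n ≃ₜ cubeJ n where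
  toFun x := ⟨twistMap i j s x, twistMap_mem_cubeJ hij s x.2⟩
  invFun x := ⟨twistMap i j (-s) x, twistMap_mem_cubeJ hij (-s) x.2⟩
  left_inv x := Subtype.ext (twistMap_neg_twistMap hij s x)
  right_inv x := Subtype.ext (by simpa using twistMap_neg_twistMap hij (-s) x)
  continuous_toFun := ((continuous_twistMap i j s).comp continuous_subtype_val).subtype_mk _
  continuous_invFun := ((continuous_twistMap i j (-s)).comp continuous_subtype_val).subtype_mk _

theorem map_cubeTwist {i j : Fin n} (hij : i ≠ j) (s : ℝ) :
    Measure.map (cubeTwist hij s) (lebesgueOnJ n) = lebesgueOnJ n := by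
  have hJ : MeasurableSet (cubeJ n) := measurableSet_Icc
  ext A hA
  have hm := (cubeTwist hij s).continuous.measurable
  rw [Measure.map_apply hm hA, lebesgueOnJ, comap_subtype_coe_apply hJ, comap_subtype_coe_apply hJ,
    ← volume_preimage_twistMap hij s (hJ.subtype_image hA) (Subtype.coe_image_subset _ _)]
  congr 1
  ext x
  constructor
  · rintro ⟨y, hy, rfl⟩
    exact ⟨_, hy, rfl⟩
  · rintro ⟨y, hy, hyx⟩
    have hx : x ∈ cubeJ n := by
      rw [← twistMap_neg_twistMap hij s x, ← hyx]
      exact twistMap_mem_cubeJ hij _ y.2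
    refine ⟨⟨x, hx⟩, ?_, rfl⟩
    have : cubeTwist hij s ⟨x, hx⟩ = y := Subtype.ext hyx.symm
    rwa [Set.mem_preimage, this]

/-- On the `i`-axis the twist angle at `r` is `1 - r ^ 2`, so a twist with `s * (1 - r ^ 2) = π`
reverses the sign of `r`. -/
theorem twistMap_single_apply {i j : Fin n} (hij : i ≠ j) {r s : ℝ} (hr : r ^ 2 ≤ 1)
    (hs : s * (1 - r ^ 2) = Real.pi) : twistMap i j s (Pi.single i r) i = -r := by
  have : twistAngle i j (Pi.single i r) = 1 - r ^ 2 := by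
    rw [twistAngle, Finset.prod_eq_one]
    · simp [hij.symm, hr]
    · intro k hk
      simp only [Finset.mem_sdiff, Finset.mem_univ, Finset.mem_insert, Finset.mem_singleton,
        true_and, not_or] at hk
      simp [hk.1]
  rw [twistMap, this, hs, planeRotation_apply_left]
  simp [hij.symm]

end Cube

theorem stmt17 (n : ℕ) (hn : 2 ≤ n) :
    ¬ IsCompact {f : C(↥(cubeJ n), ↥(cubeJ n)) |
        IsHomeomorph f ∧ (∀ x ∈ cubeJBoundary n, f x = x) ∧
        Measure.map f (lebesgueOnJ n) = lebesgueOnJ n} := by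
  intro hK
  let i : Fin n := ⟨0, by omega⟩
  have hij : i ≠ (⟨1, by omega⟩ : Fin n) := by simp [i]
  have : CompactSpace (cubeJ n) := isCompact_iff_compactSpace.1 isCompact_Icc
  let r : ℕ → ℝ := fun m => 1 - 1 / ((m : ℝ) + 1)
  have hr0 : ∀ m, 0 ≤ r m := fun m => by
    have : 1 / ((m : ℝ) + 1) ≤ 1 := by
      rw [div_le_one (by positivity)]
      linarith [m.cast_nonneg (α := ℝ)]
    simpa [r] using this
  have hr1 : ∀ m, r m < 1 := fun m => by
    have : 0 < 1 / ((m : ℝ) + 1) := by positivity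
    simpa [r] using this
  have hsq : ∀ m, r m ^ 2 < 1 := fun m => by nlinarith [hr0 m, hr1 m]
  have hsingle : ∀ t : ℝ, t ^ 2 ≤ 1 → (Pi.single i t : Fin n → ℝ) ∈ cubeJ n := fun t ht => by
    rw [mem_cubeJ_iff]
    intro k
    by_cases hk : k = i
    · subst hk
      simpa using ht
    · simp [hk]
  let p : ℕ → cubeJ n := fun m => ⟨Pi.single i (r m), hsingle _ (hsq m).le⟩
  let q : cubeJ n := ⟨Pi.single i 1, hsingle 1 (by norm_num)⟩
  have hpq : Tendsto p atTop (𝓝 q) := by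
    have hr : Tendsto r atTop (𝓝 1) := by
      simpa [r] using (tendsto_one_div_add_atTop_nhds_zero_nat (𝕜 := ℝ)).const_sub 1
    exact tendsto_subtype_rng.2
      (((continuous_single (A := fun _ : Fin n => ℝ) i).tendsto 1).comp hr)
  let f : ℕ → C(cubeJ n, cubeJ n) := fun m => cubeTwist hij (Real.pi / (1 - r m ^ 2))
  have hf : ∀ m, ((f m (p m) : cubeJ n) : Fin n → ℝ) i = -r m := fun m =>
    twistMap_single_apply hij (hsq m).le (div_mul_cancel₀ _ (by linarith [hsq m]))
  let U := hyperfilter ℕ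
  have hU : (U : Filter ℕ) ≤ atTop := Nat.hyperfilter_le_atTop
  obtain ⟨g, hg, hlim⟩ := isCompact_iff_ultrafilter_le_nhds.1 hK (U.map f) (by
    refine tendsto_principal.2 (Eventually.of_forall fun m => ⟨?_, fun x hx => ?_, ?_⟩)
    · exact (cubeTwist hij _).isHomeomorph
    · obtain ⟨k, hk⟩ := sq_eq_one_of_mem_cubeJBoundary hx
      exact Subtype.ext (twistMap_of_twistAngle_eq_zero (twistAngle_eq_zero_of_sq_eq_one hk) _)
    · exact map_cubeTwist hij _)
  have hgq : g q = q := hg.2.1 q fun h => by simpa [q] using (h i).2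
  have hev : Tendsto (fun m => f m (p m)) U (𝓝 (g q)) :=
    (ContinuousEval.continuous_eval.tendsto (g, q)).comp
      (Tendsto.prodMk_nhds (f := (U : Filter ℕ)) hlim (hpq.mono_left hU))
  have hcoord : Tendsto (fun m => ((f m (p m) : cubeJ n) : Fin n → ℝ) i) U (𝓝 1) := by
    have := (((continuous_apply i).comp continuous_subtype_val).tendsto (g q)).comp hev
    simpa [hgq, q, Function.comp_def] using this
  have := le_of_tendsto hcoord (b := (0 : ℝ))
    (Eventually.of_forall fun m => by rw [hf]; linarith [hr0 m])
  norm_num at this
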